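/- Assume in addition that P(𝚣 > log 2) > 0 and P(𝚣 < −log 2) > 0. Then there exist C > 0 and k₀ > 0 such that for every k ≥ k₀, inf_{x∈ℝ} P_x(τ_k ≤ k²) ≥ 2 (log k)^{−C}, where τ_k is the first exit time of the chain X from (−k, k) and P_x is the law of the chain started at X₀ = x. -/

import Mathlib

open MeasureTheory ProbabilityTheory Real Filter Set
open scoped ENNReal

noncomputable def hkfun (k x : ℝ) : ℝ :=
  Real.log ((Real.exp (-k) + Real.exp x) / (1 + Real.exp (x - k)))

noncomputable def chainX (k : ℝ) (zs : ℕ → ℝ) (y : ℝ) : ℕ → ℝ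
  | 0 => y
  | n + 1 => zs (n + 1) + hkfun k (chainX k zs y n)

/-- First exit time of the chain from (-k, k), with value ∞ if the chain never exits. -/
noncomputable def tauK (k : ℝ) (zs : ℕ → ℝ) (y : ℝ) : ℝ≥0∞ :=
  ⨅ (n : ℕ) (_ : k ≤ |chainX k zs y n|), (n : ℝ≥0∞)

theorem le_hkfun (k x : ℝ) : x - Real.log (1 + Real.exp (x - k)) ≤ hkfun k x := by
  have h : 0 < 1 + Real.exp (x - k) := by positivity
  rw [hkfun, Real.log_div (by positivity) h.ne']
  have : x ≤ Real.log (Real.exp (-k) + Real.exp x) := by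
    rw [Real.le_log_iff_exp_le (by positivity)]
    linarith [Real.exp_pos (-k)]
  linarith

theorem hkfun_mono {k : ℝ} (hk : 0 ≤ k) : Monotone (hkfun k) := by
  intro x y hxy
  refine Real.log_le_log (by positivity) ?_
  rw [div_le_div_iff₀ (by positivity) (by positivity), sub_eq_add_neg, sub_eq_add_neg,
    Real.exp_add, Real.exp_add]
  have h1 : Real.exp (-k) ≤ 1 := Real.exp_le_one_iff.2 (by linarith)
  have h0 := Real.exp_pos (-k)
  have h2 := Real.exp_le_exp.2 hxy
  nlinarith [mul_nonneg (sub_nonneg.2 h2) (mul_nonneg (sub_nonneg.2 h1)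
    (by linarith : 0 ≤ 1 + Real.exp (-k)))]

theorem measurable_hkfun (k : ℝ) : Measurable (hkfun k) := by
  unfold hkfun
  fun_prop

theorem chainX_mono {k : ℝ} (hk : 0 ≤ k) (zs : ℕ → ℝ) (n : ℕ) :
    Monotone fun y => chainX k zs y n := by
  induction n with
  | zero => exact monotone_id
  | succ n ih =>
    intro x y hxy
    have := hkfun_mono hk (ih hxy)
    simpa [chainX] using this

theorem chainX_add (k : ℝ) (zs : ℕ → ℝ) (y : ℝ) (j i : ℕ) :
    chainX k zs y (j + i) = chainX k (fun l => zs (l + j)) (chainX k zs y j) i := by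
  induction i with
  | zero => rfl
  | succ i ih =>
    rw [← add_assoc]
    simp only [chainX, ih]
    congr 2
    omega

/-- The driving sequences for which the chain started at `a` reaches `[c, ∞)` within `n` steps. -/
def hitSet (k : ℝ) (n : ℕ) (a c : ℝ) : Set (ℕ → ℝ) :=
  {zs | ∃ j ≤ n, c ≤ chainX k zs a j}

/-- As long as the chain stays below `c`, its drift is at least `-d`. -/
theorem mem_hitSet_of_sum_le {k a c d : ℝ} {n : ℕ} {zs : ℕ → ℝ}
    (hd : ∀ x < c, x - d ≤ hkfun k x)
    (hs : c - a + n * d ≤ ∑ i ∈ Finset.range n, zs (i + 1)) : zs ∈ hitSet k n a c := by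
  by_contra! hn
  simp only [hitSet, Set.mem_ofPred_eq, not_exists, not_and, not_le] at hn
  have key : ∀ m ≤ n, a + ∑ i ∈ Finset.range m, zs (i + 1) - m * d ≤ chainX k zs a m := by
    intro m
    induction m with
    | zero => intro _; simp [chainX]
    | succ m ih =>
      intro hm
      have h1 := ih (by omega)
      have h2 := hd _ (hn m (by omega))
      rw [Finset.sum_range_succ, chainX]
      push_cast
      linarith
  linarith [key n le_rfl, hn n le_rfl]

theorem measurable_chainX_of_forall {Ω : Type*} {m : MeasurableSpace Ω} {w : ℕ → Ω → ℝ} {n : ℕ}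
    (hw : ∀ i, 0 < i → i ≤ n → Measurable (w i)) (k a : ℝ) :
    Measurable fun ω => chainX k (fun i => w i ω) a n := by
  induction n with
  | zero => exact measurable_const
  | succ n ih =>
    exact (hw (n + 1) (by omega) le_rfl).add
      ((measurable_hkfun k).comp (ih fun i h0 hi => hw i h0 (by omega)))

theorem measurableSet_preimage_hitSet {Ω : Type*} {m : MeasurableSpace Ω} {w : ℕ → Ω → ℝ} {n : ℕ}
    (hw : ∀ i, 0 < i → i ≤ n → Measurable (w i)) (k a c : ℝ) :
    MeasurableSet {ω | (fun i => w i ω) ∈ hitSet k n a c} := by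
  have : {ω | (fun i => w i ω) ∈ hitSet k n a c}
      = ⋃ j, ⋃ (_ : j ≤ n), {ω | c ≤ chainX k (fun i => w i ω) a j} := by
    ext ω; simp [hitSet]
  rw [this]
  exact .iUnion fun j => .iUnion fun hj => measurableSet_le measurable_const
    (measurable_chainX_of_forall (fun i h0 hi => hw i h0 (hi.trans hj)) k a)

section Probability

variable {Ω : Type*} [MeasurableSpace Ω] {P : Measure Ω} {z : ℕ → Ω → ℝ}

theorem measure_shift_mem_eq (hzmeas : ∀ i, Measurable (z i)) (hindep : iIndepFun z P)
    (hid : ∀ i, P.map (z i) = P.map (z 0)) (j : ℕ) {A : Set (ℕ → ℝ)} (hA : MeasurableSet A) :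
    P {ω | (fun i => z (i + j) ω) ∈ A} = P {ω | (fun i => z i ω) ∈ A} := by
  have h1 := hindep.map_fun_eq_infinitePi_map hzmeas
  have h2 := (hindep.precomp (add_left_injective j)).map_fun_eq_infinitePi_map
    (fun i => hzmeas (i + j))
  have h3 : P.map (fun ω i => z (i + j) ω) = P.map (fun ω i => z i ω) := by
    rw [h1]
    refine h2.trans ?_
    congr 1
    funext i
    exact (hid (i + j)).trans (hid i).symm
  have h4 := DFunLike.congr_fun h3 A
  rwa [Measure.map_apply (measurable_pi_lambda _ fun i => hzmeas _) hA,
    Measure.map_apply (measurable_pi_lambda _ fun i => hzmeas _) hA] at h4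

/-- Strong Markov property at the first passage above `b`, combined with monotonicity in the
starting point. -/
theorem mul_le_measure_hitSet_add (hzmeas : ∀ i, Measurable (z i)) (hindep : iIndepFun z P)
    (hid : ∀ i, P.map (z i) = P.map (z 0)) {k : ℝ} (hk : 0 ≤ k) (n m : ℕ) (a b c : ℝ) :
    P {ω | (fun i => z i ω) ∈ hitSet k n a b} * P {ω | (fun i => z i ω) ∈ hitSet k m b c}
      ≤ P {ω | (fun i => z i ω) ∈ hitSet k (n + m) a c} := by
  classical
  let X : ℕ → Ω → ℝ := fun j ω => chainX k (fun i => z i ω) a j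
  let E : ℕ → Set Ω := fun j => {ω | b ≤ X j ω ∧ ∀ i < j, X i ω < b}
  let F : ℕ → Set Ω := fun j => {ω | (fun i => z (i + j) ω) ∈ hitSet k m b c}
  have hXmeas : ∀ j, Measurable[⨆ i ∈ Set.Iic j, (inferInstance : MeasurableSpace ℝ).comap (z i)]
      (X j) := fun j =>
    measurable_chainX_of_forall (m := ⨆ i ∈ Set.Iic j, MeasurableSpace.comap (z i) inferInstance)
      (fun i _ hi => Measurable.of_comap_le
        (le_iSup₂_of_le (f := fun i (_ : i ∈ Set.Iic j) =>
          MeasurableSpace.comap (z i) inferInstance) i hi le_rfl)) k a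
  have hE : ∀ j, MeasurableSet[⨆ i ∈ Set.Iic j, (inferInstance : MeasurableSpace ℝ).comap (z i)]
      (E j) := by
    intro j
    have hle : ∀ i ≤ j, Measurable[⨆ i ∈ Set.Iic j,
        (inferInstance : MeasurableSpace ℝ).comap (z i)] (X i) := fun i hi =>
      (hXmeas i).mono (biSup_mono fun l hl => le_trans hl hi) le_rfl
    have : E j = {ω | b ≤ X j ω} ∩ ⋂ i, ⋂ (_ : i < j), {ω | X i ω < b} := by
      ext ω; simp [E]
    rw [this]
    exact (measurableSet_le measurable_const (hXmeas j)).inter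
      (.iInter fun i => .iInter fun hi => measurableSet_lt (hle i hi.le) measurable_const)
  have hF : ∀ j, MeasurableSet[⨆ i ∈ Set.Ioi j, (inferInstance : MeasurableSpace ℝ).comap (z i)]
      (F j) := fun j =>
    measurableSet_preimage_hitSet
      (m := ⨆ i ∈ Set.Ioi j, MeasurableSpace.comap (z i) inferInstance)
      (w := fun i => z (i + j))
      (fun i hi _ => Measurable.of_comap_le
        (le_iSup₂_of_le (f := fun i (_ : i ∈ Set.Ioi j) =>
          MeasurableSpace.comap (z i) inferInstance) (i + j)
          (by simp only [Set.mem_Ioi]; omega) le_rfl)) k b c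
  have hle : ∀ S : Set ℕ, (⨆ i ∈ S, (inferInstance : MeasurableSpace ℝ).comap (z i))
      ≤ (inferInstance : MeasurableSpace Ω) := fun S =>
    iSup₂_le fun i _ => (hzmeas i).comap_le
  have hEm : ∀ j, MeasurableSet (E j) := fun j => hle _ _ (hE j)
  have hFm : ∀ j, MeasurableSet (F j) := fun j => hle _ _ (hF j)
  have hdisj : ∀ i j, i ≠ j → Disjoint (E i) (E j) := by
    intro i j hij
    rw [Set.disjoint_left]
    rintro ω ⟨h1, h2⟩ ⟨h3, h4⟩
    rcases lt_or_gt_of_ne hij with h | h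
    · exact absurd (h4 i h) (not_lt.2 h1)
    · exact absurd (h2 j h) (not_lt.2 h3)
  have hprob : ∀ j, P (E j ∩ F j)
      = P (E j) * P {ω | (fun i => z i ω) ∈ hitSet k m b c} := by
    intro j
    have hST : Disjoint (Set.Iic j) (Set.Ioi j) := by
      rw [Set.disjoint_left]; exact fun i hi hi' => absurd (Set.mem_Iic.1 hi) (not_le.2 hi')
    have hI := indep_iSup_of_disjoint (fun i => (hzmeas i).comap_le) hindep hST
    rw [(Indep_iff _ _ _).1 hI _ _ (hE j) (hF j)]
    congr 1
    exact measure_shift_mem_eq hzmeas hindep hid j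
      (measurableSet_preimage_hitSet (fun i _ _ => measurable_pi_apply i) k b c)
  have hunion : {ω | (fun i => z i ω) ∈ hitSet k n a b} ⊆ ⋃ j ∈ Finset.range (n + 1), E j := by
    rintro ω ⟨j, hj, hjb⟩
    have hex : ∃ j, b ≤ X j ω := ⟨j, hjb⟩
    simp only [Set.mem_iUnion, Finset.mem_range]
    exact ⟨Nat.find hex, Nat.lt_succ_of_le ((Nat.find_min' hex hjb).trans hj), Nat.find_spec hex,
      fun i hi => not_le.1 (Nat.find_min hex hi)⟩
  have hsub : (⋃ j ∈ Finset.range (n + 1), E j ∩ F j)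
      ⊆ {ω | (fun i => z i ω) ∈ hitSet k (n + m) a c} := by
    intro ω hω
    simp only [Set.mem_iUnion, Finset.mem_range] at hω
    obtain ⟨j, hj, ⟨hjb, -⟩, i, hi, hic⟩ := hω
    refine ⟨j + i, by omega, ?_⟩
    rw [chainX_add]
    exact hic.trans (chainX_mono hk _ i hjb)
  calc _ ≤ P (⋃ j ∈ Finset.range (n + 1), E j)
        * P {ω | (fun i => z i ω) ∈ hitSet k m b c} := by gcongr
    _ ≤ (∑ j ∈ Finset.range (n + 1), P (E j))
        * P {ω | (fun i => z i ω) ∈ hitSet k m b c} := by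
        gcongr; exact measure_biUnion_finset_le _ _
    _ = ∑ j ∈ Finset.range (n + 1), P (E j ∩ F j) := by
        rw [Finset.sum_mul]; exact Finset.sum_congr rfl fun j _ => (hprob j).symm
    _ = P (⋃ j ∈ Finset.range (n + 1), E j ∩ F j) := by
        refine (measure_biUnion_finset (fun i _ j _ hij => ?_)
          fun j _ => (hEm j).inter (hFm j)).symm
        exact (hdisj i j hij).mono inter_subset_left inter_subset_left
    _ ≤ _ := measure_mono hsub

theorem memLp_two_of_exp_tail {Z : Ω → ℝ} (hZ : Measurable Z) {δ : ℝ} (hδ : 0 < δ) (Cδ : ℝ)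
    (htail : ∀ x : ℝ, 0 ≤ x → P {ω | x < |Z ω|} ≤ ENNReal.ofReal (Cδ * Real.exp (-δ * x))) :
    MemLp Z 2 P := by
  have hint : IntegrableOn (fun t : ℝ => Cδ * (t ^ (1 : ℝ) * Real.exp (-δ * t))) (Set.Ioi 0) :=
    IntegrableOn.congr_fun
      ((integrableOn_rpow_mul_exp_neg_mul_rpow (s := 1) (p := 1) (by norm_num) zero_lt_one
        hδ).const_mul Cδ) (fun t _ => by simp) measurableSet_Ioi
  have hfin : ∫⁻ ω, ENNReal.ofReal (|Z ω| ^ (2 : ℝ)) ∂P < ∞ := by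
    rw [lintegral_rpow_eq_lintegral_meas_lt_mul P (ae_of_all _ fun ω => abs_nonneg _)
      hZ.abs.aemeasurable (by norm_num : (0 : ℝ) < 2)]
    refine ENNReal.mul_lt_top ENNReal.ofReal_lt_top ?_
    refine lt_of_le_of_lt (setLIntegral_mono' measurableSet_Ioi fun t ht => ?_)
      hint.lintegral_lt_top
    have ht' : (0 : ℝ) < t := ht
    calc _ ≤ ENNReal.ofReal (Cδ * Real.exp (-δ * t)) * ENNReal.ofReal (t ^ ((2 : ℝ) - 1)) := by
          gcongr; exact htail t ht'.le
      _ = ENNReal.ofReal (Cδ * (t ^ (1 : ℝ) * Real.exp (-δ * t))) := by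
          rw [← ENNReal.ofReal_mul' (by positivity)]
          congr 1
          norm_num
          ring
  rw [memLp_two_iff_integrable_sq hZ.aestronglyMeasurable]
  refine ⟨(hZ.pow_const 2).aestronglyMeasurable, ?_⟩
  rw [hasFiniteIntegral_iff_ofReal (ae_of_all _ fun ω => sq_nonneg _)]
  simpa using hfin

/-- By the central limit theorem, the centred walk exceeds `a * √n` with probability bounded
below. -/
theorem eventually_le_measure_sqrt_lt_sum [IsProbabilityMeasure P] {X : ℕ → Ω → ℝ}
    (hX : MemLp (X 0) 2 P)
    (hmean : ∫ ω, X 0 ω ∂P = 0) (hvar : Var[X 0; P] ≠ 0) (hindep : iIndepFun X P)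
    (hid : ∀ i, IdentDistrib (X i) (X 0) P P) (hmeas : ∀ i, Measurable (X i)) (a : ℝ) :
    ∃ c : ℝ, 0 < c ∧ ∀ᶠ n : ℕ in atTop,
      ENNReal.ofReal c ≤ P {ω | a * √n < ∑ i ∈ Finset.range n, X i ω} := by
  set v := Var[X 0; P].toNNReal with hv
  have hv0 : v ≠ 0 := by
    rw [hv, Ne, Real.toNNReal_eq_zero, not_le]
    exact lt_of_le_of_ne (variance_nonneg _ _) hvar.symm
  have hclt := (tendstoInDistribution_inv_sqrt_mul_sum_sub (Y := id) (P' := gaussianReal 0 v)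
    ⟨aemeasurable_id, Measure.map_id⟩ hX hindep hid)
  have hlim := ProbabilityMeasure.le_liminf_measure_open_of_tendsto hclt.tendsto
    (isOpen_Ioi (a := a))
  simp only [ProbabilityMeasure.coe_mk, Measure.map_id] at hlim
  have hpos : 0 < gaussianReal 0 v (Set.Ioi a) := by
    rw [pos_iff_ne_zero]
    intro h
    simpa using gaussianReal_absolutelyContinuous' 0 hv0 h
  obtain ⟨c, hc0, hc⟩ := ENNReal.lt_iff_exists_nnreal_btwn.1 hpos
  refine ⟨c, by exact_mod_cast hc0, ?_⟩
  filter_upwards [eventually_lt_of_lt_liminf (hc.trans_le hlim), eventually_gt_atTop 0]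
    with n hn hn0
  rw [ENNReal.ofReal_coe_nnreal]
  refine hn.le.trans ?_
  rw [Measure.map_apply (by fun_prop) measurableSet_Ioi]
  refine measure_mono fun ω hω => ?_
  have hs : 0 < √(n : ℝ) := Real.sqrt_pos.2 (by exact_mod_cast hn0)
  simp only [hmean, mul_zero, sub_zero, Set.mem_preimage, Set.mem_Ioi] at hω
  rw [Set.mem_ofPred_eq]
  rwa [inv_mul_eq_div, lt_div_iff₀ hs] at hω

theorem pow_le_measure_hitSet (hzmeas : ∀ i, Measurable (z i)) (hindep : iIndepFun z P)
    (hid : ∀ i, P.map (z i) = P.map (z 0)) {k a ε : ℝ} {n : ℕ} (hn : k - a ≤ n * ε) :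
    P {ω | Real.log 2 + ε < z 0 ω} ^ n ≤ P {ω | (fun i => z i ω) ∈ hitSet k n a k} := by
  have hset : P (⋂ i ∈ Finset.range n, z (i + 1) ⁻¹' Set.Ioi (Real.log 2 + ε))
      = P {ω | Real.log 2 + ε < z 0 ω} ^ n := by
    rw [(hindep.precomp (add_left_injective 1)).measure_inter_preimage_eq_mul _
      (fun i _ => measurableSet_Ioi)]
    rw [Finset.prod_congr rfl (g := fun _ => P {ω | Real.log 2 + ε < z 0 ω}), Finset.prod_const,
      Finset.card_range]
    intro i _
    have := DFunLike.congr_fun (hid (i + 1)) (Set.Ioi (Real.log 2 + ε))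
    rwa [Measure.map_apply (hzmeas _) measurableSet_Ioi,
      Measure.map_apply (hzmeas _) measurableSet_Ioi] at this
  rw [← hset]
  refine measure_mono fun ω hω => ?_
  simp only [Set.mem_iInter, Finset.mem_range, Set.mem_preimage, Set.mem_Ioi] at hω
  refine mem_hitSet_of_sum_le (d := Real.log 2) (fun x hx => ?_) ?_
  · have h1 := le_hkfun k x
    have h2 : Real.log (1 + Real.exp (x - k)) ≤ Real.log 2 := by
      refine Real.log_le_log (by positivity) ?_
      linarith [Real.exp_le_one_iff.2 (by linarith : x - k ≤ 0)]
    linarith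
  · have := Finset.card_nsmul_le_sum (Finset.range n) (fun i => z (i + 1) ω) (Real.log 2 + ε)
      fun i hi => (hω i (Finset.mem_range.1 hi)).le
    simp only [Finset.card_range, nsmul_eq_mul] at this
    linarith

end Probability

theorem exists_le_measure_hitSet_sub_two_mul_log {Ω : Type*} [MeasurableSpace Ω] {P : Measure Ω}
    {z : ℕ → Ω → ℝ} {c : ℝ}
    (hc : ∀ᶠ n : ℕ in atTop,
      ENNReal.ofReal c ≤ P {ω | 5 * √n < ∑ i ∈ Finset.range n, z (i + 1) ω}) :
    ∃ L₀ : ℝ, 5 ≤ L₀ ∧ ∀ L ≥ L₀, ∀ k : ℝ, ENNReal.ofReal c ≤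
      P {ω | (fun i => z i ω) ∈ hitSet k ⌊L ^ 2 / 4⌋₊ (k - 2 * L) (k - 2 * Real.log L)} := by
  obtain ⟨N, hN⟩ := eventually_atTop.1 hc
  refine ⟨2 * N + 5, by linarith [(Nat.cast_nonneg N : (0 : ℝ) ≤ N)], fun L hL k => ?_⟩
  have hN0 : (0 : ℝ) ≤ N := Nat.cast_nonneg N
  have hL5 : 5 ≤ L := by linarith
  have hle : (⌊L ^ 2 / 4⌋₊ : ℝ) ≤ L ^ 2 / 4 := Nat.floor_le (by positivity)
  have hlt : L ^ 2 / 4 < (⌊L ^ 2 / 4⌋₊ : ℝ) + 1 := Nat.lt_floor_add_one _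
  have hNn : N ≤ ⌊L ^ 2 / 4⌋₊ := Nat.le_floor (by nlinarith)
  refine (hN _ hNn).trans (measure_mono fun ω hω => ?_)
  have hω' : 5 * √(⌊L ^ 2 / 4⌋₊ : ℝ) < ∑ i ∈ Finset.range ⌊L ^ 2 / 4⌋₊, z (i + 1) ω := hω
  have hexp : Real.exp (-(2 * Real.log L)) = (L ^ 2)⁻¹ := by
    rw [Real.exp_neg, two_mul, Real.exp_add, Real.exp_log (by linarith), sq]
  refine mem_hitSet_of_sum_le (d := (L ^ 2)⁻¹) (fun x hx => ?_) ?_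
  · have h1 := le_hkfun k x
    have h2 : Real.log (1 + Real.exp (x - k)) ≤ Real.exp (x - k) := by
      have := Real.log_le_sub_one_of_pos (by positivity : 0 < 1 + Real.exp (x - k))
      linarith
    have h3 : Real.exp (x - k) ≤ Real.exp (-(2 * Real.log L)) :=
      Real.exp_le_exp.2 (by linarith)
    rw [hexp] at h3
    linarith
  · have h1 : (⌊L ^ 2 / 4⌋₊ : ℝ) * (L ^ 2)⁻¹ ≤ 1 / 4 := by
      rw [← div_eq_mul_inv, div_le_iff₀ (by positivity)]
      linarith
    have h2 : 1 ≤ Real.log L := by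
      rw [Real.le_log_iff_exp_le (by linarith)]
      linarith [Real.exp_one_lt_d9]
    have h3 : 2 * L / 5 ≤ √(⌊L ^ 2 / 4⌋₊ : ℝ) := Real.le_sqrt_of_sq_le (by nlinarith)
    linarith

theorem exists_pos_measure_add_lt {Ω : Type*} [MeasurableSpace Ω] {P : Measure Ω} {Z : Ω → ℝ}
    {b : ℝ} (h : 0 < P {ω | b < Z ω}) : ∃ ε : ℝ, 0 < ε ∧ 0 < P {ω | b + ε < Z ω} := by
  by_contra! hcon
  refine h.ne' (measure_mono_null (t := ⋃ n : ℕ, {ω | b + 1 / ((n : ℝ) + 1) < Z ω})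
    (fun ω hω => ?_) (measure_iUnion_null fun n => ?_))
  · obtain ⟨n, hn⟩ := exists_nat_one_div_lt (sub_pos.2 (show b < Z ω from hω))
    exact Set.mem_iUnion.2 ⟨n, by rw [Set.mem_ofPred_eq]; linarith⟩
  · exact le_antisymm (hcon _ (by positivity)) bot_le

theorem tauK_le_of_mem_hitSet {k y : ℝ} {zs : ℕ → ℝ} {n : ℕ} {T : ℝ}
    (hn : (n : ℝ) ≤ T) (h : zs ∈ hitSet k n y k) : tauK k zs y ≤ ENNReal.ofReal T := by
  obtain ⟨j, hj, hc⟩ := h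
  refine (iInf₂_le j (hc.trans (le_abs_self _))).trans ?_
  rw [← ENNReal.ofReal_natCast]
  exact ENNReal.ofReal_le_ofReal (le_trans (by exact_mod_cast hj) hn)

theorem two_mul_rpow_le_mul_pow_ceil {c p ε L : ℝ} (hc : 0 < c) (hp : 0 < p) (hp1 : p ≤ 1)
    (hε : 0 < ε) (hL1 : 1 ≤ L) (hL : 2 / (c ^ 2 * p) ≤ L) :
    2 * L ^ (-(2 / ε * (-Real.log p) + 1)) ≤ c * c * p ^ ⌈2 * Real.log L / ε⌉₊ := by
  have hL0 : 0 < L := by linarith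
  have hM : 0 ≤ Real.log L := Real.log_nonneg hL1
  have h1 : p ^ (2 * Real.log L / ε + 1) ≤ p ^ ⌈2 * Real.log L / ε⌉₊ := by
    rw [← Real.rpow_natCast]
    exact Real.rpow_le_rpow_of_exponent_ge hp hp1 (Nat.ceil_lt_add_one (by positivity)).le
  have h2 : p ^ (2 * Real.log L / ε + 1) = L ^ (-(2 / ε * (-Real.log p))) * p := by
    rw [Real.rpow_add hp, Real.rpow_one, Real.rpow_def_of_pos hp, Real.rpow_def_of_pos hL0]
    congr 2
    ring
  have h3 : L ^ (-(2 / ε * (-Real.log p) + 1)) = L ^ (-(2 / ε * (-Real.log p))) / L := by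
    rw [neg_add, ← sub_eq_add_neg, Real.rpow_sub hL0, Real.rpow_one]
  rw [h3]
  rw [div_le_iff₀ (by positivity)] at hL
  set A := L ^ (-(2 / ε * (-Real.log p))) with hA
  have hA0 : 0 < A := Real.rpow_pos_of_pos hL0 _
  calc 2 * (A / L) = 2 * A / L := by ring
    _ ≤ c * c * (A * p) := by
      rw [div_le_iff₀ hL0]
      nlinarith
    _ ≤ _ := by rw [← h2]; gcongr

/-- Uniform lower bound on the probability of exiting (-k, k) within k² steps. -/
theorem stmt17
    {Ω : Type*} [MeasurableSpace Ω] (P : Measure Ω) [IsProbabilityMeasure P]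
    (z : ℕ → Ω → ℝ) (hzmeas : ∀ i, Measurable (z i))
    (hindep : iIndepFun z P)
    (ζ : ℝ → ℝ) (hζmeas : Measurable ζ) (hζnn : ∀ x, 0 ≤ ζ x)
    (hlaw : ∀ i, Measure.map (z i) P = volume.withDensity (fun x => ENNReal.ofReal (ζ x)))
    (hmean : ∫ ω, z 0 ω ∂P = 0)
    (δ : ℝ) (hδ : 0 < δ) (Cδ : ℝ)
    (htail : ∀ x : ℝ, 0 ≤ x → P {ω | x < |z 0 ω|} ≤ ENNReal.ofReal (Cδ * Real.exp (-δ * x)))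
    (θ : ℝ) (hθ0 : 0 < θ) (hθ1 : θ ≤ 1) (Cθ : ℝ)
    (hHolder : ∀ x y : ℝ, |ζ x - ζ y| ≤ Cθ * |x - y| ^ θ)
    (h2r : 0 < P {ω | Real.log 2 < z 0 ω}) (h2l : 0 < P {ω | z 0 ω < -Real.log 2}) :
    ∃ C : ℝ, 0 < C ∧ ∃ k₀ : ℝ, 0 < k₀ ∧ ∀ k ≥ k₀,
      ENNReal.ofReal (2 * Real.log k ^ (-C))
        ≤ ⨅ x : ℝ, P {ω | tauK k (fun i => z i ω) x ≤ ENNReal.ofReal (k ^ 2)} := by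
  have hid : ∀ i, P.map (z i) = P.map (z 0) := fun i => (hlaw i).trans (hlaw 0).symm
  have hident : ∀ i j, IdentDistrib (z i) (z j) P P := fun i j =>
    ⟨(hzmeas i).aemeasurable, (hzmeas j).aemeasurable, (hid i).trans (hid j).symm⟩
  have hLp : MemLp (z 0) 2 P := memLp_two_of_exp_tail (hzmeas 0) hδ Cδ htail
  have hvar : Var[z 0; P] ≠ 0 := by
    intro h
    have hae := ae_eq_integral_of_variance_eq_zero hLp h
    refine h2r.ne' (measure_mono_null (fun ω hω => ?_) (ae_iff.1 hae))
    rw [Set.mem_ofPred_eq] at hω ⊢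
    rw [hmean]
    have : 0 < Real.log 2 := Real.log_pos (by norm_num)
    linarith
  obtain ⟨c, hc0, hc⟩ := eventually_le_measure_sqrt_lt_sum (P := P) (X := fun i => z (i + 1))
    ((hident 1 0).memLp_iff.2 hLp) ((hident 1 0).integral_eq.trans hmean)
    (by rw [(hident 1 0).variance_eq]; exact hvar)
    (hindep.precomp (add_left_injective 1)) (fun i => hident _ _) (fun i => hzmeas _) 5
  obtain ⟨L₀, hL₀, hstage⟩ := exists_le_measure_hitSet_sub_two_mul_log hc
  obtain ⟨ε, hε, hεp⟩ := exists_pos_measure_add_lt h2r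
  set q := P {ω | Real.log 2 + ε < z 0 ω} with hq
  have hqtop : q ≠ ∞ := measure_ne_top _ _
  set p := q.toReal with hp
  have hp0 : 0 < p := ENNReal.toReal_pos hεp.ne' hqtop
  have hp1 : p ≤ 1 := ENNReal.toReal_le_of_le_ofReal zero_le_one (by simpa using prob_le_one)
  have hqp : q = ENNReal.ofReal p := (ENNReal.ofReal_toReal hqtop).symm
  have hlogp : 0 ≤ -Real.log p := neg_nonneg.2 (Real.log_nonpos hp0.le hp1)
  refine ⟨2 / ε * (-Real.log p) + 1, by positivity,
    Real.exp (L₀ + 2 / (c ^ 2 * p) + 4 / ε), Real.exp_pos _, fun k hk => ?_⟩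
  have hk0 : 0 < k := (Real.exp_pos _).trans_le hk
  set L := Real.log k with hLdef
  have hcp : 0 < 2 / (c ^ 2 * p) := by positivity
  have hε4 : 0 < 4 / ε := by positivity
  have hLge : L₀ + 2 / (c ^ 2 * p) + 4 / ε ≤ L := (Real.le_log_iff_exp_le hk0).2 hk
  have hLk : L ≤ k - 1 := Real.log_le_sub_one_of_pos hk0
  have hM : Real.log L ≤ L - 1 := Real.log_le_sub_one_of_pos (by linarith)
  have hM0 : 0 ≤ Real.log L := Real.log_nonneg (by linarith)
  set n₁ := ⌊k ^ 2 / 4⌋₊ with hn₁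
  set n₂ := ⌊L ^ 2 / 4⌋₊ with hn₂
  set n₃ := ⌈2 * Real.log L / ε⌉₊ with hn₃
  have htime : ((n₁ + n₂ + n₃ : ℕ) : ℝ) ≤ k ^ 2 := by
    have h1 : (n₁ : ℝ) ≤ k ^ 2 / 4 := Nat.floor_le (by positivity)
    have h2 : (n₂ : ℝ) ≤ L ^ 2 / 4 := Nat.floor_le (by positivity)
    have h3 : (n₃ : ℝ) < 2 * Real.log L / ε + 1 := Nat.ceil_lt_add_one (by positivity)
    have h4 : 2 * Real.log L / ε ≤ 4 / ε * k / 2 := by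
      rw [show 4 / ε * k / 2 = 2 * k / ε by ring]
      gcongr
      linarith
    push_cast
    nlinarith
  have hlow : ENNReal.ofReal (2 * L ^ (-(2 / ε * (-Real.log p) + 1)))
      ≤ P {ω | (fun i => z i ω) ∈ hitSet k (n₁ + n₂ + n₃) (-k) k} := by
    have s1 := hstage k (by linarith) k
    rw [show k - 2 * k = -k by ring] at s1
    have s2 := hstage L (by linarith) k
    have s3 := pow_le_measure_hitSet hzmeas hindep hid (k := k) (a := k - 2 * Real.log L)
      (ε := ε) (n := n₃) (by
        have := Nat.le_ceil (2 * Real.log L / ε)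
        rw [div_le_iff₀ hε] at this
        linarith)
    rw [← hq, hqp] at s3
    calc _ ≤ ENNReal.ofReal (c * c * p ^ n₃) := ENNReal.ofReal_le_ofReal
          (two_mul_rpow_le_mul_pow_ceil hc0 hp0 hp1 hε (by linarith) (by linarith))
      _ = ENNReal.ofReal c * ENNReal.ofReal c * ENNReal.ofReal p ^ n₃ := by
          rw [ENNReal.ofReal_mul (by positivity), ENNReal.ofReal_mul hc0.le,
            ENNReal.ofReal_pow hp0.le]
      _ ≤ _ := mul_le_mul' (mul_le_mul' s1 s2) s3
      _ ≤ _ :=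
        (mul_le_mul_left (mul_le_measure_hitSet_add hzmeas hindep hid hk0.le _ _ _ _ _) _).trans
          (mul_le_measure_hitSet_add hzmeas hindep hid hk0.le _ _ _ _ _)
  refine le_iInf fun x => hlow.trans (measure_mono fun ω hω => ?_)
  rw [Set.mem_ofPred_eq]
  rcases le_or_gt x (-k) with hx | hx
  · exact (iInf₂_le 0 (by rw [chainX]; exact le_abs.2 (Or.inr (by linarith)))).trans (by simp)
  · obtain ⟨j, hj, hc⟩ := hω
    exact tauK_le_of_mem_hitSet htime ⟨j, hj, hc.trans (chainX_mono hk0.le _ j hx.le)⟩
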